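/- Assume (H1), (H2), (H3), (H_fitz), suppose limsup_{t→∞} λ(t)β(t) < 2μ, and let x be a strong global solution of the dynamical system. Define x̃ : (0,∞) → H by x̃(t) = (1/∫₀^t λ(s) ds) ∫₀^t λ(s) x(s) ds. Then x̃(t) converges weakly, as t → ∞, to an element of zer(A + D + N_C). -/

import Mathlib

open scoped RealInnerProductSpace Pointwise
open MeasureTheory Filter

variable {H : Type*} [NormedAddCommGroup H] [InnerProductSpace ℝ H]

/-- A set-valued operator `A : H ⇒ H` (given by its value map) is monotone. -/
def MonotoneOperator (A : H → Set H) : Prop :=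
  ∀ ⦃x u y v : H⦄, u ∈ A x → v ∈ A y → (0:ℝ) ≤ ⟪x - y, u - v⟫

/-- `A` is maximally monotone: monotone and without proper monotone extension. -/
def MaximallyMonotone (A : H → Set H) : Prop :=
  MonotoneOperator A ∧ ∀ A' : H → Set H, MonotoneOperator A' → (∀ x, A x ⊆ A' x) → A' = A

/-- `A` is `γ`-strongly monotone. -/
def StronglyMonotoneOperator (γ : ℝ) (A : H → Set H) : Prop :=
  ∀ ⦃x u y v : H⦄, u ∈ A x → v ∈ A y → γ * ‖x - y‖ ^ 2 ≤ ⟪x - y, u - v⟫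

/-- A single-valued operator `T` is `γ`-cocoercive. -/
def Cocoercive (γ : ℝ) (T : H → H) : Prop :=
  ∀ x y : H, γ * ‖T x - T y‖ ^ 2 ≤ ⟪x - y, T x - T y⟫

/-- The normal cone of a set `C` at `z` (empty when `z ∉ C`). -/
def normalCone (C : Set H) (z : H) : Set H :=
  {u | z ∈ C ∧ ∀ y ∈ C, ⟪y - z, u⟫ ≤ (0:ℝ)}

/-- The support function `σ_C`, with values in `ℝ ∪ {±∞}`. -/
noncomputable def supportFn (C : Set H) (u : H) : EReal :=
  ⨆ y ∈ C, ((⟪y, u⟫ : ℝ) : EReal)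

/-- The Fitzpatrick function of a single-valued operator `B`. -/
noncomputable def fitzpatrick (B : H → H) (x u : H) : EReal :=
  ⨆ y : H, ((⟪x, B y⟫ + ⟪y, u⟫ - ⟪y, B y⟫ : ℝ) : EReal)

/-- Conversion of an extended real into `[0,∞]` (negative values go to `0`). -/
noncomputable def erealToENNReal (x : EReal) : ENNReal :=
  if x = ⊤ then ⊤ else ENNReal.ofReal x.toReal

/-- Absolute continuity of `f` on `[0,b]`, via the `ε`-`η` definition. -/
def AbsolutelyContinuousOnIcc (f : ℝ → H) (b : ℝ) : Prop :=
  ∀ ε > (0:ℝ), ∃ η > (0:ℝ), ∀ (n : ℕ) (a c : Fin n → ℝ),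
    (∀ k, 0 ≤ a k ∧ a k ≤ c k ∧ c k ≤ b) →
    (Pairwise fun i j => Disjoint (Set.Ioo (a i) (c i)) (Set.Ioo (a j) (c j))) →
    ∑ k, (c k - a k) < η → ∑ k, ‖f (c k) - f (a k)‖ < ε

/-- A strong global solution `x`, with derivative function `xd`, of the dynamical system
`ẋ(t) + x(t) = J_{λ(t)A}(x(t) − λ(t)Dx(t) − λ(t)β(t)Bx(t))`, `x(0) = x₀`, where the
resolvent equation is expressed as the differential inclusion
`x(t) − λ(t)Dx(t) − λ(t)β(t)Bx(t) − (ẋ(t)+x(t)) ∈ λ(t) A(ẋ(t)+x(t))`. -/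
def IsStrongGlobalSolution (A : H → Set H) (D B : H → H) (lam beta : ℝ → ℝ)
    (x₀ : H) (x xd : ℝ → H) : Prop :=
  (∀ b > (0:ℝ), AbsolutelyContinuousOnIcc x b) ∧ x 0 = x₀ ∧
  ∀ᵐ t ∂(volume.restrict (Set.Ici (0:ℝ))),
    HasDerivAt x (xd t) t ∧
    x t - lam t • D (x t) - (lam t * beta t) • B (x t) - (xd t + x t)
      ∈ lam t • A (xd t + x t)

/-- The solution set `zer(A + D + N_C)`. -/
def zerSum (A : H → Set H) (D : H → H) (C : Set H) : Set H :=
  {z | ∃ v ∈ A z, ∃ p ∈ normalCone C z, v + D z + p = 0}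



lemma aux_ac {f : ℝ → H} {b : ℝ} (hb : 0 ≤ b) (hf : AbsolutelyContinuousOnIcc f b) :
    AbsolutelyContinuousOnInterval f 0 b := by
  rw [absolutelyContinuousOnInterval_iff]
  intro ε hε
  obtain ⟨η, hη, h⟩ := hf ε hε
  refine ⟨η, hη, ?_⟩
  rintro ⟨n, I⟩ hE hlen
  obtain ⟨h1, h2⟩ := hE
  simp only at h1 h2 hlen ⊢
  have key := h n (fun k => min (I k).1 (I k).2) (fun k => max (I k).1 (I k).2) ?_ ?_ ?_
  · rw [← Fin.sum_univ_eq_sum_range (fun i => dist (f (I i).1) (f (I i).2))]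
    refine lt_of_le_of_lt (Finset.sum_le_sum fun k _ => ?_) key
    rcases le_total (I k).1 (I k).2 with hk | hk
    · simp [hk, dist_eq_norm, norm_sub_rev]
    · simp [hk, dist_eq_norm]
  · intro k
    have := h1 k (by simp)
    rw [Set.uIcc_of_le hb] at this
    obtain ⟨⟨p, q⟩, ⟨r, s⟩⟩ := this
    exact ⟨le_min p r, min_le_max, max_le q s⟩
  · intro i j hij
    have := h2 (by simp : (i : ℕ) ∈ (Finset.range n : Set ℕ)) (by simp : (j : ℕ) ∈ (Finset.range n : Set ℕ))
      (fun hh => hij (Fin.ext hh))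
    exact this.mono Set.Ioo_subset_Ioc_self Set.Ioo_subset_Ioc_self
  · rw [← Fin.sum_univ_eq_sum_range (fun i => dist (I i).1 (I i).2)] at hlen
    refine lt_of_le_of_lt (Finset.sum_le_sum fun k _ => ?_) hlen
    simp [Real.dist_eq, max_sub_min_eq_abs']

lemma aux_ftc {x : ℝ → H} {s t : ℝ} (u : H) (hst : s ≤ t)
    (hx : AbsolutelyContinuousOnInterval x s t) {g : ℝ → ℝ}
    (hg : IntervalIntegrable g volume s t)
    (h : ∀ᵐ τ, τ ∈ Set.Icc s t → ∃ d, HasDerivAt x d τ ∧ (⟪x τ - u, d⟫ : ℝ) ≤ g τ) :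
    ‖x t - u‖ ^ 2 / 2 - ‖x s - u‖ ^ 2 / 2 ≤ ∫ τ in s..t, g τ := by
  have h1 : AbsolutelyContinuousOnInterval (fun τ => ‖x τ - u‖) s t := by
    refine squeeze_zero (fun E => Finset.sum_nonneg fun _ _ => dist_nonneg) (fun E => ?_) hx
    refine Finset.sum_le_sum fun i _ => ?_
    rw [Real.dist_eq, dist_eq_norm]
    refine (abs_norm_sub_norm_le _ _).trans (le_of_eq ?_)
    congr 1; abel
  have h2 : AbsolutelyContinuousOnInterval (fun τ => (1/2 : ℝ) * (‖x τ - u‖ * ‖x τ - u‖)) s t :=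
    (h1.fun_mul h1).const_mul _
  have h3 := h2.integral_deriv_eq_sub
  have h4 : ‖x t - u‖ ^ 2 / 2 - ‖x s - u‖ ^ 2 / 2 =
      ∫ τ in s..t, deriv (fun τ => (1/2 : ℝ) * (‖x τ - u‖ * ‖x τ - u‖)) τ := by
    rw [h3]; ring
  rw [h4]
  apply intervalIntegral.integral_mono_ae_restrict hst h2.intervalIntegrable_deriv hg
  rw [Filter.EventuallyLE, ae_restrict_iff' measurableSet_Icc]
  filter_upwards [h] with τ hτ hmem
  obtain ⟨d, hd, hle⟩ := hτ hmem
  have hd' : HasDerivAt (fun τ => x τ - u) d τ := hd.sub_const u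
  have h5 := (hd'.inner ℝ hd').const_mul (1/2 : ℝ)
  have h6 : (fun τ => (1/2 : ℝ) * (‖x τ - u‖ * ‖x τ - u‖)) =
      fun τ => (1/2 : ℝ) * ⟪x τ - u, x τ - u⟫ := by
    ext τ; rw [real_inner_self_eq_norm_mul_norm]
  rw [h6, h5.deriv, real_inner_comm (x τ - u) d]
  linarith

/-- Integral inequality lemma. -/
lemma aux_conv {h a b c : ℝ → ℝ} {T : ℝ} (hh : ContinuousOn h (Set.Ici T))
    (hc : ContinuousOn c (Set.Ici T))
    (hh0 : ∀ t, 0 ≤ h t) (ha0 : ∀ t, 0 ≤ a t) (hb0 : ∀ t, 0 ≤ b t) (hc0 : ∀ t ≥ T, 0 ≤ c t)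
    (ha : IntegrableOn a (Set.Ici T)) (hb : IntegrableOn b (Set.Ici T))
    (hac : ContinuousOn a (Set.Ici T))
    (hineq : ∀ s t, T ≤ s → s ≤ t → h t - h s ≤ ∫ τ in s..t, (b τ + a τ * h τ - c τ)) :
    (∃ l, Tendsto h atTop (nhds l)) ∧ ∃ K, ∀ t ≥ T, ∫ τ in T..t, c τ ≤ K := by
  have iis : ∀ {f : ℝ → ℝ}, IntegrableOn f (Set.Ici T) → ∀ s t, T ≤ s → T ≤ t →
      IntervalIntegrable f volume s t := by
    intro f hf s t hs ht
    refine (hf.mono_set ?_).intervalIntegrable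
    intro r hr
    rcases le_total s t with h | h <;> simp [h] at hr <;> exact le_trans (by assumption) hr.1
  have iic : ∀ {f : ℝ → ℝ}, ContinuousOn f (Set.Ici T) → ∀ s t, T ≤ s → T ≤ t →
      IntervalIntegrable f volume s t := by
    intro f hf s t hs ht
    refine (hf.mono ?_).intervalIntegrable
    intro r hr
    rcases le_total s t with h | h <;> simp [h] at hr <;> exact le_trans (by assumption) hr.1
  have hah : ContinuousOn (fun τ => a τ * h τ) (Set.Ici T) := hac.mul hh
  -- choose T1
  have hT1 : ∃ T1 ≥ T, ∀ t ≥ T1, ∫ τ in T1..t, a τ ≤ 1 / 2 := by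
    have ht := intervalIntegral_tendsto_integral_Ioi T (ha.mono_set Set.Ioi_subset_Ici_self) tendsto_id
    have h1 := ht.eventually (lt_mem_nhds (show (∫ x in Set.Ioi T, a x) - 1/2 < ∫ x in Set.Ioi T, a x by linarith))
    obtain ⟨T1, h2, h3⟩ := (h1.and (eventually_ge_atTop T)).exists
    refine ⟨T1, h3, fun t htt => ?_⟩
    have h4 := intervalIntegral.integral_add_adjacent_intervals (iis ha T T1 le_rfl h3) (iis ha T1 t h3 (le_trans h3 htt))
    have h5 : ∫ τ in T..t, a τ ≤ ∫ x in Set.Ioi T, a x := by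
      rw [intervalIntegral.integral_of_le (le_trans h3 htt)]
      exact setIntegral_mono_set (ha.mono_set Set.Ioi_subset_Ici_self) (ae_of_all _ ha0)
        (ae_of_all _ Set.Ioc_subset_Ioi_self)
    simp only [id] at h2
    linarith
  obtain ⟨T1, hT1, hT1a⟩ := hT1
  set Ib := ∫ x in Set.Ioi T, b x with hIb
  have hbI : ∀ s t, T ≤ s → s ≤ t → ∫ τ in s..t, b τ ≤ Ib := by
    intro s t hs hst
    rw [intervalIntegral.integral_of_le hst]
    exact setIntegral_mono_set (hb.mono_set Set.Ioi_subset_Ici_self) (ae_of_all _ hb0)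
        (ae_of_all _ (fun r hr => lt_of_le_of_lt hs hr.1))
  have hbound1 : ∀ t ≥ T1, h t ≤ 2 * (h T1 + Ib) := by
    intro t ht
    obtain ⟨m, hm, hmax⟩ := isCompact_Icc.exists_isMaxOn (Set.nonempty_Icc.2 ht)
      (hh.mono (fun r (hr : r ∈ Set.Icc T1 t) => hT1.le.trans hr.1))
    have hmT : T ≤ m := hT1.le.trans hm.1
    have h1 := hineq T1 m hT1 hm.1
    have h2 : ∫ τ in T1..m, (b τ + a τ * h τ - c τ) ≤ ∫ τ in T1..m, (b τ + a τ * h m) := by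
      apply intervalIntegral.integral_mono_on hm.1
        (((iis hb _ _ hT1 hmT).add (iic hah _ _ hT1 hmT)).sub (iic hc _ _ hT1 hmT))
        ((iis hb _ _ hT1 hmT).add ((iis ha _ _ hT1 hmT).mul_const _))
      intro r hr
      have := hc0 r (hT1.le.trans hr.1)
      have h4 : h r ≤ h m := hmax ⟨hr.1, hr.2.trans hm.2⟩
      have := mul_le_mul_of_nonneg_left h4 (ha0 r)
      linarith
    rw [intervalIntegral.integral_add (iis hb _ _ hT1 hmT) ((iis ha _ _ hT1 hmT).mul_const _),
      intervalIntegral.integral_mul_const] at h2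
    have h3 := hbI T1 m hT1 hm.1
    have h4 := mul_le_mul_of_nonneg_right (hT1a m hm.1) (hh0 m)
    have h5 : h t ≤ h m := hmax ⟨ht, le_rfl⟩
    linarith
  have hbound : ∃ M, ∀ t ≥ T, h t ≤ M := by
    obtain ⟨M, hM⟩ := isCompact_Icc.exists_bound_of_continuousOn
      (hh.mono (fun r (hr : r ∈ Set.Icc T T1) => hr.1))
    refine ⟨max M (2 * (h T1 + Ib)), fun t ht => ?_⟩
    rcases le_total t T1 with h1 | h1
    · exact le_max_of_le_left ((le_abs_self _).trans (hM t ⟨ht, h1⟩))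
    · exact le_max_of_le_right (hbound1 t h1)
  obtain ⟨M, hM⟩ := hbound
  -- g = b + a h is integrable
  have hg : IntegrableOn (fun τ => b τ + a τ * h τ) (Set.Ici T) := by
    refine hb.add ?_
    refine Integrable.mono' (ha.mul_const M) (hah.aestronglyMeasurable measurableSet_Ici) ?_
    rw [ae_restrict_iff' measurableSet_Ici]
    refine ae_of_all _ fun r hr => ?_
    rw [Real.norm_of_nonneg (mul_nonneg (ha0 r) (hh0 r))]
    exact mul_le_mul_of_nonneg_left (hM r hr) (ha0 r)
  have hg0 : ∀ r, 0 ≤ b r + a r * h r := fun r => add_nonneg (hb0 r) (mul_nonneg (ha0 r) (hh0 r))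
  set Ig := ∫ x in Set.Ioi T, (b x + a x * h x) with hIg
  have hgI : ∀ t, T ≤ t → ∫ τ in T..t, (b τ + a τ * h τ) ≤ Ig := by
    intro t hst
    rw [intervalIntegral.integral_of_le hst]
    exact setIntegral_mono_set (hg.mono_set Set.Ioi_subset_Ici_self) (ae_of_all _ hg0)
        (ae_of_all _ Set.Ioc_subset_Ioi_self)
  have hsplit : ∀ s t, T ≤ s → s ≤ t → h t - h s ≤ (∫ τ in s..t, (b τ + a τ * h τ)) - ∫ τ in s..t, c τ := by
    intro s t hs hst
    rw [← intervalIntegral.integral_sub (iis hg _ _ hs (hs.trans hst)) (iic hc _ _ hs (hs.trans hst))]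
    exact hineq s t hs hst
  constructor
  · set G : ℝ → ℝ := fun t => h (max T t) - ∫ τ in T..(max T t), (b τ + a τ * h τ) with hG
    have hanti : Antitone G := by
      intro s t hst
      have h1 : T ≤ max T s := le_max_left _ _
      have h2 : max T s ≤ max T t := max_le_max le_rfl hst
      have h3 := hsplit _ _ h1 h2
      have h4 : 0 ≤ ∫ τ in (max T s)..(max T t), c τ :=
        intervalIntegral.integral_nonneg h2 fun r hr => hc0 r (h1.trans hr.1)
      have h5 := intervalIntegral.integral_add_adjacent_intervals
        (iis hg T _ le_rfl h1) (iis hg _ _ h1 (h1.trans h2))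
      simp only [hG]
      linarith
    have hbdd : BddBelow (Set.range G) := by
      refine ⟨-Ig, ?_⟩
      rintro _ ⟨t, rfl⟩
      have := hgI (max T t) (le_max_left _ _)
      have := hh0 (max T t)
      simp only [hG]; linarith
    have h1 := tendsto_atTop_ciInf hanti hbdd
    have h2 := intervalIntegral_tendsto_integral_Ioi T (hg.mono_set Set.Ioi_subset_Ici_self) tendsto_id
    refine ⟨_, (h1.add h2).congr' ?_⟩
    filter_upwards [eventually_ge_atTop T] with t ht
    simp [hG, max_eq_right ht]
  · refine ⟨h T + Ig, fun t ht => ?_⟩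
    have := hsplit T t le_rfl ht
    have := hgI t ht
    have := hh0 t
    linarith

lemma aux_lip {γ : ℝ} (hγ : 0 < γ) {T : H → H} (hT : Cocoercive γ T) (x y : H) :
    ‖T x - T y‖ ≤ γ⁻¹ * ‖x - y‖ := by
  have h1 := hT x y
  have h2 := real_inner_le_norm (x - y) (T x - T y)
  rcases (norm_nonneg (T x - T y)).eq_or_lt with h | h
  · rw [← h]; positivity
  · have h3 : γ * ‖T x - T y‖ ≤ ‖x - y‖ := by
      by_contra! h4
      nlinarith [mul_lt_mul_of_pos_right h4 h]
    rw [inv_mul_eq_div, le_div_iff₀ hγ]; linarith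

lemma aux_cont {γ : ℝ} (hγ : 0 < γ) {T : H → H} (hT : Cocoercive γ T) : Continuous T := by
  have : LipschitzWith ⟨γ⁻¹, by positivity⟩ T := LipschitzWith.of_dist_le_mul fun x y => by
    rw [dist_eq_norm, dist_eq_norm]; exact aux_lip hγ hT x y
  exact this.continuous

lemma aux_pointwise {A : H → Set H} (hA : MonotoneOperator A) {μ l b : ℝ} {D B : H → H}
    (hB : Cocoercive μ B) (hl : 0 < l) (hb : 0 < b) (hlb : l * b ≤ 2 * μ)
    {x d u v p : H} (hv : v ∈ A u) (hu : B u = 0)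
    (hm : x - l • D x - (l * b) • B x - (d + x) ∈ l • A (d + x)) :
    (⟪x - u, d⟫ : ℝ) ≤ (l * ⟪x - u, (3:ℝ) • p⟫ - l * b * ⟪x - u, B x⟫) / 3
      - l * ⟪x - u, D x + v + p⟫ + l ^ 2 * ‖D x + v‖ ^ 2 := by
  obtain ⟨w, hw, hwe⟩ := Set.mem_smul_set.1 hm
  have h1 := mul_nonneg hl.le (hA hw hv)
  have h2 : l * (⟪d + x - u, w - v⟫ : ℝ) =
      ⟪d + (x - u), -d - l • (D x + v) - (l * b) • B x⟫ := by
    rw [← inner_smul_right, smul_sub, hwe]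
    congr 1
    · abel
    · rw [smul_add]; abel
  rw [h2] at h1
  have hBx := hB x u
  rw [hu, sub_zero] at hBx
  set e := x - u
  set f := D x + v
  set g := B x
  have h3 := sq_nonneg ‖(1/2:ℝ) • d + l • f‖
  have h4 := sq_nonneg ‖(1/2:ℝ) • d + (l * b / 3) • g‖
  rw [norm_add_sq_real] at h3 h4
  simp only [norm_smul, inner_smul_left, inner_smul_right, inner_add_left, inner_add_right,
    inner_sub_right, inner_neg_right, mul_pow, Real.norm_eq_abs, sq_abs, real_inner_self_eq_norm_sq,
    RCLike.conj_to_real] at h1 h3 h4 ⊢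
  have hlb0 : 0 < l * b := mul_pos hl hb
  have h5 : l * b * (l * b) * ‖g‖ ^ 2 ≤ l * b * (2 * μ) * ‖g‖ ^ 2 := by
    gcongr
  have h6 : l * b * (μ * ‖g‖ ^ 2) ≤ l * b * ⟪e, g⟫ := by
    gcongr
  nlinarith

lemma aux_fitz {l b : ℝ} {B : H → H} (hl : 0 < l) (hb : 0 < b) {u p : H}
    (hp : p ∈ normalCone {q : H | B q = 0} u) (x : H) :
    ENNReal.ofReal (l * ⟪x - u, p⟫ - l * b * ⟪x - u, B x⟫) ≤ ENNReal.ofReal (l * b) *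
        erealToENNReal ((⨆ u ∈ {q : H | B q = 0}, fitzpatrick B u (b⁻¹ • p)) -
          supportFn {q : H | B q = 0} (b⁻¹ • p)) := by
  obtain ⟨huC, hn⟩ := hp
  have hs : supportFn {q : H | B q = 0} (b⁻¹ • p) = ((⟪u, b⁻¹ • p⟫ : ℝ) : EReal) := by
    apply le_antisymm
    · refine iSup₂_le fun y hy => ?_
      rw [EReal.coe_le_coe_iff, inner_smul_right, inner_smul_right]
      have := hn y hy
      rw [inner_sub_left] at this
      exact mul_le_mul_of_nonneg_left (by linarith) (by positivity)
    · exact le_iSup₂ (f := fun y (_ : y ∈ {q : H | B q = 0}) => ((⟪y, b⁻¹ • p⟫ : ℝ) : EReal)) u huC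
  have hF : ((⟪u, B x⟫ + ⟪x, b⁻¹ • p⟫ - ⟪x, B x⟫ : ℝ) : EReal) ≤
      ⨆ u ∈ {q : H | B q = 0}, fitzpatrick B u (b⁻¹ • p) := by
    refine le_trans ?_ (le_iSup₂ (f := fun y (_ : y ∈ {q : H | B q = 0}) =>
      fitzpatrick B y (b⁻¹ • p)) u huC)
    exact le_iSup (fun y => ((⟪u, B y⟫ + ⟪y, b⁻¹ • p⟫ - ⟪y, B y⟫ : ℝ) : EReal)) x
  rw [hs]
  set F := ⨆ u ∈ {q : H | B q = 0}, fitzpatrick B u (b⁻¹ • p)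
  set r : ℝ := ⟪u, B x⟫ + ⟪x, b⁻¹ • p⟫ - ⟪x, B x⟫ - ⟪u, b⁻¹ • p⟫ with hr
  have hF2 : (r : EReal) ≤ F - ((⟪u, b⁻¹ • p⟫ : ℝ) : EReal) := by
    rw [hr, EReal.coe_sub]
    exact EReal.sub_le_sub hF le_rfl
  have hkey : ∀ y : EReal, (r : EReal) ≤ y → ENNReal.ofReal r ≤ erealToENNReal y := by
    intro y hy
    unfold erealToENNReal
    split_ifs with h
    · exact le_top
    · apply ENNReal.ofReal_le_ofReal
      have := EReal.toReal_le_toReal hy (EReal.coe_ne_bot _) h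
      simpa using this
  refine le_trans (le_of_eq ?_) (mul_le_mul_right (hkey _ hF2) _)
  rw [← ENNReal.ofReal_mul (by positivity)]
  congr 1
  rw [hr]
  simp only [inner_smul_right, inner_sub_left]
  field_simp
  ring

/-- Auxiliary perturbation term. -/
noncomputable def auxP (lam beta : ℝ → ℝ) (B : H → H) (x : ℝ → H) (u p : H) (t : ℝ) : ℝ :=
  max ((lam t * ⟪x t - u, (3:ℝ) • p⟫ - lam t * beta t * ⟪x t - u, B (x t)⟫) / 3) 0

lemma auxP_nonneg (lam beta : ℝ → ℝ) (B : H → H) (x : ℝ → H) (u p : H) (t : ℝ) :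
    0 ≤ auxP lam beta B x u p t := le_max_right _ _

lemma auxP_cont {lam beta : ℝ → ℝ} {B : H → H} {x : ℝ → H} (u p : H) {S : Set ℝ}
    (hlc : ContinuousOn lam S) (hbc : ContinuousOn beta S)
    (hxc : ContinuousOn x S) (hBc : Continuous B) :
    ContinuousOn (auxP lam beta B x u p) S := by
  unfold auxP
  have := hBc.comp_continuousOn hxc
  simp only [Function.comp_def] at this
  fun_prop

lemma auxP_int {lam beta : ℝ → ℝ} {B : H → H} {x : ℝ → H} {u p : H}
    (hlam_pos : ∀ t : ℝ, 0 ≤ t → 0 < lam t) (hbeta_pos : ∀ t : ℝ, 0 ≤ t → 0 < beta t)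
    (hlc : ContinuousOn lam (Set.Ici 0)) (hbc : ContinuousOn beta (Set.Ici 0))
    (hxc : ContinuousOn x (Set.Ici 0)) (hBc : Continuous B)
    (hfitz : ∀ p z : H, p ∈ normalCone {q : H | B q = 0} z →
      ∫⁻ t in Set.Ici (0:ℝ), ENNReal.ofReal (lam t * beta t) *
        erealToENNReal ((⨆ u ∈ {q : H | B q = 0}, fitzpatrick B u ((beta t)⁻¹ • p)) -
          supportFn {q : H | B q = 0} ((beta t)⁻¹ • p)) < ⊤)
    (hp : p ∈ normalCone {q : H | B q = 0} u) :
    IntegrableOn (auxP lam beta B x u p) (Set.Ici 0) := by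
  have hp3 : (3:ℝ) • p ∈ normalCone {q : H | B q = 0} u := by
    refine ⟨hp.1, fun y hy => ?_⟩
    have := hp.2 y hy
    rw [inner_smul_right]; linarith
  refine ⟨(auxP_cont u p hlc hbc hxc hBc).aestronglyMeasurable measurableSet_Ici, ?_⟩
  rw [hasFiniteIntegral_iff_ofReal (ae_of_all _ (auxP_nonneg lam beta B x u p))]
  refine lt_of_le_of_lt (setLIntegral_mono' measurableSet_Ici fun t ht => ?_) (hfitz _ u hp3)
  refine le_trans ?_ (aux_fitz (hlam_pos t ht) (hbeta_pos t ht) hp3 (x t))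
  unfold auxP
  rw [ENNReal.ofReal_le_ofReal_iff']
  rcases le_total (lam t * ⟪x t - u, (3:ℝ) • p⟫ - lam t * beta t * ⟪x t - u, B (x t)⟫) 0 with h | h
  · right
    exact max_le (by linarith) le_rfl
  · left
    exact max_le (by linarith) h

lemma aux_main_ineq {A : H → Set H} (hA : MonotoneOperator A) {μ T : ℝ} {D B : H → H}
    {lam beta : ℝ → ℝ} {x xd : ℝ → H}
    (hB : Cocoercive μ B) (hT0 : 0 ≤ T)
    (hT : ∀ t ≥ T, lam t * beta t ≤ 2 * μ)
    (hlam_pos : ∀ t : ℝ, 0 ≤ t → 0 < lam t) (hbeta_pos : ∀ t : ℝ, 0 ≤ t → 0 < beta t)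
    (hac : ∀ s t, 0 ≤ s → s ≤ t → AbsolutelyContinuousOnInterval x s t)
    (hode : ∀ᵐ t ∂(volume.restrict (Set.Ici (0:ℝ))),
      HasDerivAt x (xd t) t ∧
      x t - lam t • D (x t) - (lam t * beta t) • B (x t) - (xd t + x t)
        ∈ lam t • A (xd t + x t))
    {u v p : H} (hv : v ∈ A u) (hu : B u = 0) (s t : ℝ) (hs : T ≤ s) (hst : s ≤ t) {g : ℝ → ℝ}
    (hg : IntervalIntegrable g volume s t)
    (hle : ∀ τ ≥ T, auxP lam beta B x u p τ
      - lam τ * ⟪x τ - u, D (x τ) + v + p⟫ + lam τ ^ 2 * ‖D (x τ) + v‖ ^ 2 ≤ g τ) :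
    ‖x t - u‖ ^ 2 / 2 - ‖x s - u‖ ^ 2 / 2 ≤ ∫ τ in s..t, g τ := by
  apply aux_ftc u hst (hac s t (hT0.trans hs) hst) hg
  rw [ae_restrict_iff' measurableSet_Ici] at hode
  filter_upwards [hode] with τ hτ hm
  have h0 : 0 ≤ τ := hT0.trans (hs.trans hm.1)
  obtain ⟨h1, h2⟩ := hτ h0
  refine ⟨_, h1, ?_⟩
  have h3 := aux_pointwise hA hB (hlam_pos τ h0) (hbeta_pos τ h0) (hT τ (hs.trans hm.1)) (p := p) hv hu h2
  have h4 := hle τ (hs.trans hm.1)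
  have h5 : (lam τ * ⟪x τ - u, (3:ℝ) • p⟫ - lam τ * beta τ * ⟪x τ - u, B (x τ)⟫) / 3 ≤ auxP lam beta B x u p τ :=
    le_max_left _ _
  linarith

lemma aux_weak [CompleteSpace H] {f : ℝ → H} {M : ℝ} (𝒰 : Ultrafilter ℝ)
    (hb : ∀ᶠ t in (𝒰 : Filter ℝ), ‖f t‖ ≤ M) :
    ∃ z : H, ∀ u : H, Tendsto (fun t => (⟪f t, u⟫ : ℝ)) 𝒰 (nhds ⟪z, u⟫) := by
  have hex : ∀ u : H, ∃ a : ℝ, Tendsto (fun t => (⟪f t, u⟫ : ℝ)) 𝒰 (nhds a) := by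
    intro u
    have hK : IsCompact (Set.Icc (-(M * ‖u‖)) (M * ‖u‖)) := isCompact_Icc
    have hle : ((𝒰.map fun t => (⟪f t, u⟫ : ℝ) : Ultrafilter ℝ) : Filter ℝ) ≤
        𝓟 (Set.Icc (-(M * ‖u‖)) (M * ‖u‖)) := by
      rw [le_principal_iff, Ultrafilter.coe_map, mem_map]
      filter_upwards [hb] with t ht
      have h1 := abs_real_inner_le_norm (f t) u
      have h2 := mul_le_mul_of_nonneg_right ht (norm_nonneg u)
      exact abs_le.1 (h1.trans h2)
    obtain ⟨a, -, ha⟩ := hK.ultrafilter_le_nhds _ hle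
    exact ⟨a, ha⟩
  choose φ hφ using hex
  let L : H →ₗ[ℝ] ℝ :=
    { toFun := φ
      map_add' := fun u v => by
        refine tendsto_nhds_unique (hφ (u + v)) ?_
        simpa only [inner_add_right] using (hφ u).add (hφ v)
      map_smul' := fun c u => by
        refine tendsto_nhds_unique (hφ (c • u)) ?_
        simpa only [inner_smul_right, RingHom.id_apply, smul_eq_mul] using (hφ u).const_mul c }
  have hL : ∀ u, ‖L u‖ ≤ M * ‖u‖ := by
    intro u
    refine le_of_tendsto (hφ u).norm ?_
    filter_upwards [hb] with t ht
    exact (norm_inner_le_norm _ _).trans (mul_le_mul_of_nonneg_right ht (norm_nonneg u))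
  let L' : StrongDual ℝ H := L.mkContinuous M hL
  refine ⟨(InnerProductSpace.toDual ℝ H).symm L', fun u => ?_⟩
  rw [InnerProductSpace.toDual_symm_apply]
  exact hφ u

lemma aux_avg [CompleteSpace H] {lam : ℝ → ℝ} {x xt : ℝ → H}
    (hlc : ContinuousOn lam (Set.Ici 0)) (hxc : ContinuousOn x (Set.Ici 0))
    (hlam_pos : ∀ t : ℝ, 0 ≤ t → 0 < lam t)
    (hΛ : Tendsto (fun t => ∫ s in (0:ℝ)..t, lam s) atTop atTop)
    (hxt : ∀ t : ℝ, xt t = (∫ s in (0:ℝ)..t, lam s)⁻¹ • ∫ s in (0:ℝ)..t, lam s • x s)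
    {w : H} {L : ℝ}
    (h : ∀ δ > 0, ∃ K T, 0 ≤ T ∧ ∀ t ≥ T, ∫ s in T..t, lam s * (⟪x s, w⟫ - L) ≤
      K + δ * ∫ s in T..t, lam s)
    {𝒰 : Filter ℝ} [𝒰.NeBot] (hU : 𝒰 ≤ atTop) {m : ℝ}
    (hm : Tendsto (fun t => (⟪xt t, w⟫ : ℝ)) 𝒰 (nhds m)) : m ≤ L := by
  apply le_of_forall_pos_le_add
  intro ε hε
  obtain ⟨K, T, hT0, hK⟩ := h (ε / 2) (by positivity)
  have hci : ∀ {E : Type _} [NormedAddCommGroup E] {f : ℝ → E}, ContinuousOn f (Set.Ici 0) →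
      ∀ s t, 0 ≤ s → s ≤ t → IntervalIntegrable f volume s t := by
    intro E _ f hf s t hs hst
    refine (hf.mono ?_).intervalIntegrable
    rw [Set.uIcc_of_le hst]
    exact fun r hr => hs.trans hr.1
  have hci' : ∀ {f : ℝ → H}, ContinuousOn f (Set.Ici 0) →
      ∀ s t, 0 ≤ s → s ≤ t → IntervalIntegrable f volume s t := by
    intro f hf s t hs hst
    refine (hf.mono ?_).intervalIntegrable
    rw [Set.uIcc_of_le hst]
    exact fun r hr => hs.trans hr.1
  have hc1 : ContinuousOn (fun s => lam s * (⟪x s, w⟫ - L)) (Set.Ici 0) := by fun_prop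
  refine le_of_tendsto hm (hU ?_)
  have hcl : ∀ K' : ℝ, ∀ᶠ t in atTop, K' ≤ ∫ s in (0:ℝ)..t, lam s := fun K' =>
    hΛ.eventually (eventually_ge_atTop K')
  set K1 := |∫ s in (0:ℝ)..T, lam s * (⟪x s, w⟫ - L)| + |K| with hK1
  filter_upwards [hcl 1, hcl (K1 / (ε / 2)), eventually_ge_atTop T] with t h1 h2 ht
  have e1 := intervalIntegral.integral_add_adjacent_intervals (hci hc1 0 T le_rfl hT0) (hci hc1 T t hT0 ht)
  have e2 := intervalIntegral.integral_add_adjacent_intervals (hci hlc 0 T le_rfl hT0) (hci hlc T t hT0 ht)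
  have e3 : 0 ≤ ∫ s in (0:ℝ)..T, lam s :=
    intervalIntegral.integral_nonneg hT0 fun r hr => (hlam_pos r hr.1).le
  have e4 := hK t ht
  set Λ := ∫ s in (0:ℝ)..t, lam s with hΛd
  have e5 : (⟪∫ s in (0:ℝ)..t, lam s • x s, w⟫ : ℝ) = ∫ s in (0:ℝ)..t, lam s * ⟪x s, w⟫ := by
    have hsm : ContinuousOn (fun s => lam s • x s) (Set.Ici 0) := hlc.smul hxc
    have := (innerSL ℝ w).intervalIntegral_comp_comm (hci' hsm 0 t le_rfl (hT0.trans ht))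
    simp only [innerSL_apply_apply, inner_smul_right] at this
    rw [real_inner_comm, ← this]
    refine intervalIntegral.integral_congr fun s _ => ?_
    simp only [real_inner_comm (x s) w]
  have e6 : ∫ s in (0:ℝ)..t, lam s * (⟪x s, w⟫ - L) = (∫ s in (0:ℝ)..t, lam s * ⟪x s, w⟫) - Λ * L := by
    simp only [mul_sub]
    rw [intervalIntegral.integral_sub, intervalIntegral.integral_mul_const]
    · exact hci (by fun_prop) 0 t le_rfl (hT0.trans ht)
    · exact hci (by fun_prop) 0 t le_rfl (hT0.trans ht)
  rw [hxt, inner_smul_left, e5]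
  simp only [RCLike.conj_to_real]
  rw [← hΛd, inv_mul_eq_div, div_le_iff₀ (by linarith)]
  rw [div_le_iff₀ (by positivity)] at h2
  have a1 := le_abs_self (∫ s in (0:ℝ)..T, lam s * (⟪x s, w⟫ - L))
  have a2 := le_abs_self K
  have a3 := mul_nonneg (half_pos hε).le e3
  nlinarith

lemma aux_max {M : H → Set H} (hM : MaximallyMonotone M) {z d : H}
    (h : ∀ u q, q ∈ M u → (⟪z, d + q⟫ : ℝ) ≤ ⟪u, d + q⟫) : -d ∈ M z := by
  have h1 : ∀ u q, q ∈ M u → (0:ℝ) ≤ ⟪u - z, q - -d⟫ := by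
    intro u q hq
    have := h u q hq
    rw [sub_neg_eq_add, inner_sub_left, add_comm q d]
    linarith
  have := hM.2 (fun y => M y ∪ {r | y = z ∧ r = -d}) ?_ (fun y => Set.subset_union_left)
  · rw [← this]; right; exact ⟨rfl, rfl⟩
  · intro a q b r hq hr
    rcases hq with hq | ⟨rfl, rfl⟩ <;> rcases hr with hr | ⟨rfl, rfl⟩
    · exact hM.1 hq hr
    · exact h1 _ _ hq
    · have := h1 _ _ hr
      rw [← neg_sub b a, ← neg_sub r (-d), inner_neg_neg]
      exact this
    · simp

lemma aux_Deq {η : ℝ} (hη : 0 < η) {D : H → H} (hD : Cocoercive η D) {z d : H}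
    (h : ∀ y, (⟪z, D y - d⟫ : ℝ) ≤ ⟪y, D y - d⟫) : D z = d := by
  set e := d - D z with he
  have h1 := h (z + (η / 2) • e)
  rw [inner_add_left, inner_smul_left] at h1
  simp only [RCLike.conj_to_real] at h1
  have h2 : (0:ℝ) ≤ ⟪e, D (z + (η / 2) • e) - d⟫ := by
    by_contra! hc
    nlinarith [mul_neg_of_pos_of_neg (half_pos hη) hc]
  have h3 : D (z + (η / 2) • e) - d = (D (z + (η / 2) • e) - D z) - e := by rw [he]; abel
  have h4 := aux_lip hη hD (z + (η / 2) • e) z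
  rw [add_sub_cancel_left, norm_smul, Real.norm_of_nonneg (by positivity)] at h4
  have h5 : η⁻¹ * (η / 2 * ‖e‖) = ‖e‖ / 2 := by field_simp
  rw [h5] at h4
  rw [h3, inner_sub_right, real_inner_self_eq_norm_sq] at h2
  have h6 := real_inner_le_norm e (D (z + (η / 2) • e) - D z)
  have h7 := mul_le_mul_of_nonneg_left h4 (norm_nonneg e)
  have h8 : ‖e‖ ^ 2 ≤ 0 := by nlinarith
  have h9 : e = 0 := by
    have : ‖e‖ = 0 := by nlinarith [norm_nonneg e]
    exact norm_eq_zero.1 this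
  rw [he, sub_eq_zero] at h9
  exact h9.symm

/-- Theorem, part (ii): weak ergodic convergence of the trajectory to a point
of `zer(A + D + N_C)`; weak convergence is expressed via inner products. -/
theorem main_theorem_part_ii [CompleteSpace H]
    (A : H → Set H) (hA : MaximallyMonotone A)
    (η μ : ℝ) (hη : 0 < η) (hμ : 0 < μ)
    (D B : H → H) (hD : Cocoercive η D) (hB : Cocoercive μ B)
    (hC : {q : H | B q = 0}.Nonempty)
    (lam beta : ℝ → ℝ)
    (hlam_pos : ∀ t : ℝ, 0 ≤ t → 0 < lam t) (hbeta_pos : ∀ t : ℝ, 0 ≤ t → 0 < beta t)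
    (hH1 : ∀ b > (0:ℝ), ContinuousOn lam (Set.Icc 0 b) ∧ ContinuousOn beta (Set.Icc 0 b))
    (hH2 : MaximallyMonotone (fun q => A q + normalCone {q' : H | B q' = 0} q) ∧
      (zerSum A D {q : H | B q = 0}).Nonempty)
    (hH3 : IntegrableOn (fun t => lam t ^ 2) (Set.Ici (0:ℝ)) volume ∧
      ∫⁻ t in Set.Ici (0:ℝ), ENNReal.ofReal (lam t) = ⊤)
    (hfitz : ∀ p z : H, p ∈ normalCone {q : H | B q = 0} z →
      ∫⁻ t in Set.Ici (0:ℝ), ENNReal.ofReal (lam t * beta t) *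
        erealToENNReal ((⨆ u ∈ {q : H | B q = 0}, fitzpatrick B u ((beta t)⁻¹ • p)) -
          supportFn {q : H | B q = 0} ((beta t)⁻¹ • p)) < ⊤)
    (hls : limsup (fun t => ((lam t * beta t : ℝ) : EReal)) atTop < ((2 * μ : ℝ) : EReal))
    (x₀ : H) (x xd : ℝ → H)
    (hsol : IsStrongGlobalSolution A D B lam beta x₀ x xd)
    (xt : ℝ → H)
    (hxt : ∀ t : ℝ, xt t = (∫ s in (0:ℝ)..t, lam s)⁻¹ • ∫ s in (0:ℝ)..t, lam s • x s) :
    ∃ xinf ∈ zerSum A D {q : H | B q = 0},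
      ∀ u : H, Tendsto (fun t => (⟪xt t, u⟫ : ℝ)) atTop (nhds ⟪xinf, u⟫) := by
  classical
  have hDc := aux_cont hη hD
  have hBc := aux_cont hμ hB
  have hlift : ∀ {E : Type _} [TopologicalSpace E] {f : ℝ → E},
      (∀ b > (0:ℝ), ContinuousOn f (Set.Icc 0 b)) → ContinuousOn f (Set.Ici 0) := by
    intro E _ f hf t ht
    have h1 := hf (t + 1) (by linarith [Set.mem_Ici.1 ht]) t ⟨ht, by linarith⟩
    refine h1.mono_of_mem_nhdsWithin ?_
    have : Set.Iio (t + 1) ∈ nhds t := Iio_mem_nhds (by linarith)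
    filter_upwards [self_mem_nhdsWithin, mem_nhdsWithin_of_mem_nhds this] with r hr1 hr2
    exact ⟨hr1, le_of_lt hr2⟩
  have hlc : ContinuousOn lam (Set.Ici 0) := hlift fun b hb => (hH1 b hb).1
  have hbc : ContinuousOn beta (Set.Ici 0) := hlift fun b hb => (hH1 b hb).2
  obtain ⟨hsac, -, hode⟩ := hsol
  have hac : ∀ s t, 0 ≤ s → s ≤ t → AbsolutelyContinuousOnInterval x s t := by
    intro s t hs hst
    have h1 := aux_ac (b := t + 1) (by linarith) (hsac (t + 1) (by linarith))
    refine h1.mono ?_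
    rw [Set.uIcc_of_le hst, Set.uIcc_of_le (by linarith)]
    exact Set.Icc_subset_Icc hs (by linarith)
  have hxc : ContinuousOn x (Set.Ici 0) := by
    intro t ht
    have h1 := (hac 0 (t + 1) le_rfl (by linarith [Set.mem_Ici.1 ht])).continuousOn
    rw [Set.uIcc_of_le (by linarith [Set.mem_Ici.1 ht])] at h1
    refine (h1 t ⟨ht, by linarith⟩).mono_of_mem_nhdsWithin ?_
    have : Set.Iio (t + 1) ∈ nhds t := Iio_mem_nhds (by linarith)
    filter_upwards [self_mem_nhdsWithin, mem_nhdsWithin_of_mem_nhds this] with r hr1 hr2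
    exact ⟨hr1, le_of_lt hr2⟩
  have hDx : ContinuousOn (fun t => D (x t)) (Set.Ici 0) := hDc.comp_continuousOn hxc
  have hci : ∀ {f : ℝ → ℝ}, ContinuousOn f (Set.Ici 0) →
      ∀ s t, 0 ≤ s → s ≤ t → IntervalIntegrable f volume s t := by
    intro f hf s t hs hst
    refine (hf.mono ?_).intervalIntegrable
    rw [Set.uIcc_of_le hst]
    exact fun r hr => hs.trans hr.1
  obtain ⟨T, hT0, hT⟩ : ∃ T, 0 ≤ T ∧ ∀ t ≥ T, lam t * beta t ≤ 2 * μ := by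
    have h1 := eventually_lt_of_limsup_lt hls
    obtain ⟨T, hT⟩ := eventually_atTop.1 h1
    refine ⟨max T 0, le_max_right _ _, fun t ht => ?_⟩
    have := hT t ((le_max_left _ _).trans ht)
    exact (EReal.coe_lt_coe_iff.1 this).le
  have hTs : Set.Ici T ⊆ Set.Ici 0 := Set.Ici_subset_Ici.2 hT0
  obtain ⟨hl2, hltop⟩ := hH3
  have hΛ : Tendsto (fun t => ∫ s in (0:ℝ)..t, lam s) atTop atTop := by
    have hmono : Monotone (fun t => ∫ s in (0:ℝ)..(max 0 t), lam s) := by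
      intro s t hst
      have h1 : (0:ℝ) ≤ max 0 s := le_max_left _ _
      have h2 : max 0 s ≤ max 0 t := max_le_max le_rfl hst
      have h3 := intervalIntegral.integral_add_adjacent_intervals (hci hlc 0 _ le_rfl h1) (hci hlc _ _ h1 h2)
      have h4 : 0 ≤ ∫ r in (max 0 s)..(max 0 t), lam r :=
        intervalIntegral.integral_nonneg h2 fun r hr => (hlam_pos r (h1.trans hr.1)).le
      simp only
      linarith
    have h1 : Tendsto (fun t => ∫ s in (0:ℝ)..(max 0 t), lam s) atTop atTop := by
      apply tendsto_atTop_atTop_of_monotone hmono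
      by_contra! hcon
      obtain ⟨I, hI⟩ := hcon
      have h2 : IntegrableOn lam (Set.Ioi 0) := by
        refine integrableOn_Ioi_of_intervalIntegral_norm_bounded (b := fun t : ℝ => max 0 t) (l := atTop) I 0 ?_ ?_ ?_
        · intro t
          exact (hci hlc 0 (max 0 t) le_rfl (le_max_left _ _)).1
        · exact tendsto_atTop_mono (fun t => le_max_right _ _) tendsto_id
        · refine Eventually.of_forall fun t => ?_
          refine le_trans (le_of_eq ?_) (hI t).le
          refine intervalIntegral.integral_congr fun r hr => ?_
          rw [Set.uIcc_of_le (le_max_left _ _)] at hr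
          exact Real.norm_of_nonneg (hlam_pos r hr.1).le
      have h3 : IntegrableOn lam (Set.Ici 0) := by
        rw [integrableOn_Ici_iff_integrableOn_Ioi]; exact h2
      have h4 := h3.2
      rw [hasFiniteIntegral_iff_ofReal] at h4
      · rw [hltop] at h4; exact lt_irrefl _ h4
      · rw [Filter.EventuallyLE, ae_restrict_iff' measurableSet_Ici]
        exact ae_of_all _ fun r hr => (hlam_pos r hr).le
    refine h1.congr' ?_
    filter_upwards [eventually_ge_atTop 0] with t ht
    rw [max_eq_right ht]
  -- Step 1 : estimates at solutions
  have stepZ : ∀ z ∈ zerSum A D {q : H | B q = 0},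
      (∃ l, Tendsto (fun t => ‖x t - z‖ ^ 2 / 2) atTop (nhds l)) ∧
      ∃ K, ∀ t ≥ T, ∫ τ in T..t, lam τ * ‖D (x τ) - D z‖ ^ 2 ≤ K := by
    rintro z ⟨v, hv, p, hp, hsum⟩
    have hPc := auxP_cont z p hlc hbc hxc hBc
    have hPi := auxP_int hlam_pos hbeta_pos hlc hbc hxc hBc hfitz hp
    have key := aux_conv (T := T) (h := fun t => ‖x t - z‖ ^ 2 / 2)
      (a := fun t => 4 * η⁻¹ ^ 2 * lam t ^ 2)
      (b := fun t => auxP lam beta B x z p t + 2 * ‖p‖ ^ 2 * lam t ^ 2)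
      (c := fun t => η * (lam t * ‖D (x t) - D z‖ ^ 2))
      (ContinuousOn.mono (by fun_prop) hTs) (ContinuousOn.mono (by fun_prop) hTs)
      (fun t => by positivity) (fun t => by positivity)
      (fun t => add_nonneg (auxP_nonneg _ _ _ _ _ _ _) (by positivity))
      (fun t ht => by have := (hlam_pos t (hT0.trans ht)).le; positivity)
      ((hl2.mono_set hTs).const_mul _)
      ((hPi.mono_set hTs).add ((hl2.mono_set hTs).const_mul _))
      (ContinuousOn.mono (by fun_prop) hTs)
      (by
        intro s t hs hst
        refine aux_main_ineq hA.1 hB hT0 hT hlam_pos hbeta_pos hac hode hv hp.1 s t hs hst (p := p)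
          (hci (by fun_prop) s t (hT0.trans hs) hst) ?_
        intro τ hτ
        have hl := hlam_pos τ (hT0.trans hτ)
        have e1 : D (x τ) + v + p = D (x τ) - D z := by
          have : v + p = - D z := by
            rw [eq_neg_iff_add_eq_zero, ← hsum]; abel
          rw [add_assoc, this]; abel
        have e2 : D (x τ) + v = (D (x τ) - D z) - p := by rw [← e1]; abel
        have e3 : ‖D (x τ) + v‖ ^ 2 ≤ 2 * ‖D (x τ) - D z‖ ^ 2 + 2 * ‖p‖ ^ 2 := by
          rw [e2]
          have h1 := norm_sub_le (D (x τ) - D z) p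
          have h2 := norm_nonneg ((D (x τ) - D z) - p)
          nlinarith [sq_nonneg (‖D (x τ) - D z‖ - ‖p‖)]
        have e4 : ‖D (x τ) - D z‖ ^ 2 ≤ η⁻¹ ^ 2 * ‖x τ - z‖ ^ 2 := by
          rw [← mul_pow]
          exact pow_le_pow_left₀ (norm_nonneg _) (aux_lip hη hD _ _) 2
        have e5 := mul_le_mul_of_nonneg_left (hD (x τ) z) hl.le
        have e6 := mul_le_mul_of_nonneg_left e3 (sq_nonneg (lam τ))
        have e7 := mul_le_mul_of_nonneg_left e4 (sq_nonneg (lam τ))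
        rw [e1]
        linarith)
    refine ⟨key.1, ?_⟩
    obtain ⟨K, hK⟩ := key.2
    refine ⟨K / η, fun t ht => ?_⟩
    have := hK t ht
    rw [intervalIntegral.integral_const_mul] at this
    rw [le_div_iff₀ hη]; linarith
  obtain ⟨z0, hz0⟩ := hH2.2
  obtain ⟨⟨l0, hl0⟩, K0, hK0⟩ := stepZ z0 hz0
  -- boundedness
  obtain ⟨R, hR⟩ : ∃ R, ∀ t ≥ 0, ‖x t‖ ≤ R := by
    have h1 := hl0.eventually (gt_mem_nhds (show l0 < l0 + 1 by linarith))
    obtain ⟨T1, hT1⟩ := eventually_atTop.1 h1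
    obtain ⟨M, hM⟩ := isCompact_Icc.exists_bound_of_continuousOn
      (hxc.mono (fun r (hr : r ∈ Set.Icc 0 T1) => hr.1))
    refine ⟨max M (‖z0‖ + (2 * (l0 + 1) + 1)), fun t ht => ?_⟩
    rcases le_total t T1 with h | h
    · exact le_max_of_le_left (hM t ⟨ht, h⟩)
    · apply le_max_of_le_right
      have h2 := hT1 t h
      have h3 : ‖x t - z0‖ ≤ 2 * (l0 + 1) + 1 := by
        nlinarith [sq_nonneg (‖x t - z0‖ - 1), sq_nonneg (‖x t - z0‖)]
      have h4 := norm_add_le (x t - z0) z0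
      rw [sub_add_cancel] at h4
      linarith
  have hR0 : 0 ≤ R := (norm_nonneg _).trans (hR 0 le_rfl)
  have hxtb : ∀ᶠ t in atTop, ‖xt t‖ ≤ R := by
    filter_upwards [hΛ.eventually (eventually_ge_atTop 1), eventually_ge_atTop 0] with t h1 ht
    have h2 : ‖∫ s in (0:ℝ)..t, lam s • x s‖ ≤ ∫ s in (0:ℝ)..t, lam s * R := by
      refine intervalIntegral.norm_integral_le_of_norm_le ht (ae_of_all _ fun r hr => ?_)
        (hci (by fun_prop) 0 t le_rfl ht)
      have := hlam_pos r hr.1.le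
      rw [norm_smul, Real.norm_of_nonneg this.le]
      exact mul_le_mul_of_nonneg_left (hR r hr.1.le) this.le
    rw [intervalIntegral.integral_mul_const] at h2
    rw [hxt, norm_smul, norm_inv, Real.norm_of_nonneg (by linarith), inv_mul_eq_div,
      div_le_iff₀ (by linarith)]
    linarith
  set d0 := D z0 with hd0
  have young : ∀ (δ : ℝ), 0 < δ → ∀ u : H, ∀ t ≥ 0,
      |(⟪x t - u, D (x t) - d0⟫ : ℝ)| ≤ δ + (R + ‖u‖) ^ 2 / (4 * δ) * ‖D (x t) - d0‖ ^ 2 := by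
    intro δ hδ u t ht
    have h1 := abs_real_inner_le_norm (x t - u) (D (x t) - d0)
    have h2 : ‖x t - u‖ ≤ R + ‖u‖ := (norm_sub_le _ _).trans (by linarith [hR t ht])
    have h3 := mul_le_mul_of_nonneg_right h2 (norm_nonneg (D (x t) - d0))
    have h4 : (R + ‖u‖) * ‖D (x t) - d0‖ ≤ δ + (R + ‖u‖) ^ 2 / (4 * δ) * ‖D (x t) - d0‖ ^ 2 := by
      have h5 : δ + (R + ‖u‖) ^ 2 / (4 * δ) * ‖D (x t) - d0‖ ^ 2 - (R + ‖u‖) * ‖D (x t) - d0‖ =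
          (2 * δ - (R + ‖u‖) * ‖D (x t) - d0‖) ^ 2 / (4 * δ) := by
        field_simp; ring
      have h6 : 0 ≤ (2 * δ - (R + ‖u‖) * ‖D (x t) - d0‖) ^ 2 / (4 * δ) := by positivity
      linarith
    linarith
  have hl2T : ∀ t ≥ T, ∫ τ in T..t, lam τ ^ 2 ≤ ∫ τ in Set.Ici 0, lam τ ^ 2 := by
    intro t ht
    rw [intervalIntegral.integral_of_le ht]
    exact setIntegral_mono_set hl2 (ae_of_all _ fun _ => sq_nonneg _)
      (ae_of_all _ fun r hr => hT0.trans hr.1.le)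
  have claim1 : ∀ (u v p : H), v ∈ A u → p ∈ normalCone {q : H | B q = 0} u → ∀ δ > 0,
      ∃ K T, 0 ≤ T ∧ ∀ t ≥ T, ∫ s in T..t, lam s * (⟪x s, d0 + (v + p)⟫ - ⟪u, d0 + (v + p)⟫) ≤
        K + δ * ∫ s in T..t, lam s := by
    intro u v p hv hp δ hδ
    have hPc := auxP_cont u p hlc hbc hxc hBc
    have hPi := auxP_int hlam_pos hbeta_pos hlc hbc hxc hBc hfitz hp
    set N := η⁻¹ * (R + ‖z0‖) + ‖d0 + v‖ with hN
    set c := (R + ‖u‖) ^ 2 / (4 * δ) with hc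
    have hc0 : 0 ≤ c := by positivity
    refine ⟨‖x T - u‖ ^ 2 / 2 + (∫ τ in Set.Ici 0, auxP lam beta B x u p τ)
      + N ^ 2 * (∫ τ in Set.Ici 0, lam τ ^ 2) + c * K0, T, hT0, fun t ht => ?_⟩
    have i1 := hci hPc T t hT0 ht
    have i2 := hci (f := fun τ => N ^ 2 * lam τ ^ 2) (by fun_prop) T t hT0 ht
    have i3 := hci (f := fun τ => δ * lam τ) (by fun_prop) T t hT0 ht
    have i4 := hci (f := fun τ => c * (lam τ * ‖D (x τ) - d0‖ ^ 2)) (by fun_prop) T t hT0 ht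
    have i5 := hci (f := fun τ => lam τ * (⟪x τ, d0 + (v + p)⟫ - ⟪u, d0 + (v + p)⟫)) (by fun_prop) T t hT0 ht
    have main := aux_main_ineq hA.1 hB hT0 hT hlam_pos hbeta_pos hac hode hv hp.1 T t le_rfl ht (p := p)
      ((((i1.add i2).add i3).add i4).sub i5) (by
        intro τ hτ
        have hτ0 := hT0.trans hτ
        have hl := hlam_pos τ hτ0
        have e1 : ‖D (x τ) + v‖ ≤ N := by
          have h1 : D (x τ) + v = (D (x τ) - d0) + (d0 + v) := by abel
          have h2 := aux_lip hη hD (x τ) z0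
          have h3 : ‖x τ - z0‖ ≤ R + ‖z0‖ := (norm_sub_le _ _).trans (by linarith [hR τ hτ0])
          have h4 := mul_le_mul_of_nonneg_left h3 (inv_pos.2 hη).le
          rw [h1]
          refine (norm_add_le _ _).trans ?_
          rw [hN]; linarith
        have e2 : ‖D (x τ) + v‖ ^ 2 ≤ N ^ 2 := pow_le_pow_left₀ (norm_nonneg _) e1 2
        have e3 := mul_le_mul_of_nonneg_left e2 (sq_nonneg (lam τ))
        have e4 := mul_le_mul_of_nonneg_left ((neg_le_abs _).trans (young δ hδ u τ hτ0)) hl.le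
        have e5 : D (x τ) + v + p = (D (x τ) - d0) + (d0 + (v + p)) := by abel
        rw [e5, inner_add_right, ← inner_sub_left]
        linarith)
    rw [intervalIntegral.integral_sub (((i1.add i2).add i3).add i4) i5,
      intervalIntegral.integral_add ((i1.add i2).add i3) i4,
      intervalIntegral.integral_add (i1.add i2) i3, intervalIntegral.integral_add i1 i2,
      intervalIntegral.integral_const_mul, intervalIntegral.integral_const_mul,
      intervalIntegral.integral_const_mul] at main
    have b1 : ∫ τ in T..t, auxP lam beta B x u p τ ≤ ∫ τ in Set.Ici 0, auxP lam beta B x u p τ := by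
      rw [intervalIntegral.integral_of_le ht]
      exact setIntegral_mono_set hPi (ae_of_all _ fun _ => auxP_nonneg _ _ _ _ _ _ _)
        (ae_of_all _ fun r hr => hT0.trans hr.1.le)
    have b2 := mul_le_mul_of_nonneg_left (hl2T t ht) (sq_nonneg N)
    have b3 := mul_le_mul_of_nonneg_left (hK0 t ht) hc0
    have b4 : 0 ≤ ‖x t - u‖ ^ 2 / 2 := by positivity
    linarith
  have claim2 : ∀ (y : H), ∀ δ > 0,
      ∃ K T, 0 ≤ T ∧ ∀ t ≥ T, ∫ s in T..t, lam s * (⟪x s, D y - d0⟫ - ⟪y, D y - d0⟫) ≤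
        K + δ * ∫ s in T..t, lam s := by
    intro y δ hδ
    set c := (R + ‖y‖) ^ 2 / (4 * δ) with hc
    have hc0 : 0 ≤ c := by positivity
    refine ⟨c * K0, T, hT0, fun t ht => ?_⟩
    have i3 := hci (f := fun τ => δ * lam τ) (by fun_prop) T t hT0 ht
    have i4 := hci (f := fun τ => c * (lam τ * ‖D (x τ) - d0‖ ^ 2)) (by fun_prop) T t hT0 ht
    have i5 := hci (f := fun τ => lam τ * (⟪x τ, D y - d0⟫ - ⟪y, D y - d0⟫)) (by fun_prop) T t hT0 ht
    have main := intervalIntegral.integral_mono_on ht i5 (i4.add i3) (by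
      intro τ hτ
      have hτ0 := hT0.trans hτ.1
      have hl := hlam_pos τ hτ0
      have e4 := mul_le_mul_of_nonneg_left ((le_abs_self _).trans (young δ hδ y τ hτ0)) hl.le
      have e5 : D (x τ) - d0 = (D (x τ) - D y) + (D y - d0) := by abel
      have e6 : 0 ≤ η * ‖D (x τ) - D y‖ ^ 2 := by positivity
      have e7 := mul_nonneg hl.le (e6.trans (hD (x τ) y))
      have e8 : (⟪x τ - y, D (x τ) - d0⟫ : ℝ) = ⟪x τ - y, D (x τ) - D y⟫ + ⟪x τ - y, D y - d0⟫ := by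
        rw [← inner_add_right, ← e5]
      rw [e8] at e4
      rw [← inner_sub_left]
      linarith)
    rw [intervalIntegral.integral_add i4 i3, intervalIntegral.integral_const_mul,
      intervalIntegral.integral_const_mul] at main
    have b3 := mul_le_mul_of_nonneg_left (hK0 t ht) hc0
    linarith
  have cesaro : ∀ (w : H) (L : ℝ), Tendsto (fun t => (⟪x t, w⟫ : ℝ)) atTop (nhds L) → ∀ δ > 0,
      ∃ K T, 0 ≤ T ∧ ∀ t ≥ T, ∫ s in T..t, lam s * (⟪x s, w⟫ - L) ≤
        K + δ * ∫ s in T..t, lam s := by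
    intro w L hL δ hδ
    obtain ⟨T1, hT1⟩ := eventually_atTop.1 (hL.eventually (gt_mem_nhds (show L < L + δ by linarith)))
    refine ⟨0, max T1 0, le_max_right _ _, fun t ht => ?_⟩
    rw [zero_add, ← intervalIntegral.integral_const_mul]
    refine intervalIntegral.integral_mono_on ht (hci (by fun_prop) _ t (le_max_right _ _) ht)
      (hci (by fun_prop) _ t (le_max_right _ _) ht) fun r hr => ?_
    have h1 := hT1 r ((le_max_left _ _).trans hr.1)
    have h2 := hlam_pos r ((le_max_right _ _).trans hr.1)
    nlinarith
  -- cluster points are solutions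
  have cluster : ∀ 𝒰 : Ultrafilter ℝ, (𝒰 : Filter ℝ) ≤ atTop →
      ∃ z ∈ zerSum A D {q : H | B q = 0},
        ∀ u : H, Tendsto (fun t => (⟪xt t, u⟫ : ℝ)) 𝒰 (nhds ⟪z, u⟫) := by
    intro 𝒰 hU
    obtain ⟨z, hz⟩ := aux_weak 𝒰 (hU hxtb)
    refine ⟨z, ?_, hz⟩
    have h1 : -d0 ∈ A z + normalCone {q' : H | B q' = 0} z := by
      refine aux_max hH2.1 ?_
      intro u q hq
      obtain ⟨v, hv, p, hp, rfl⟩ := Set.mem_add.1 hq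
      exact aux_avg hlc hxc hlam_pos hΛ hxt (claim1 u v p hv hp) hU (hz _)
    have h2 : D z = d0 := aux_Deq hη hD fun y =>
      aux_avg hlc hxc hlam_pos hΛ hxt (claim2 y) hU (hz _)
    obtain ⟨v, hv, p, hp, hvp⟩ := Set.mem_add.1 h1
    refine ⟨v, hv, p, hp, ?_⟩
    rw [h2, add_right_comm, hvp, neg_add_cancel]
  have cesaro_eq : ∀ (w : H) (L : ℝ), Tendsto (fun t => (⟪x t, w⟫ : ℝ)) atTop (nhds L) →
      ∀ 𝒰 : Ultrafilter ℝ, (𝒰 : Filter ℝ) ≤ atTop → ∀ m : ℝ,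
      Tendsto (fun t => (⟪xt t, w⟫ : ℝ)) 𝒰 (nhds m) → m = L := by
    intro w L hL 𝒰 hU m hm
    apply le_antisymm
    · exact aux_avg hlc hxc hlam_pos hΛ hxt (cesaro w L hL) hU hm
    · have h1 : Tendsto (fun t => (⟪x t, -w⟫ : ℝ)) atTop (nhds (-L)) := by
        simpa only [inner_neg_right] using hL.neg
      have h2 : Tendsto (fun t => (⟪xt t, -w⟫ : ℝ)) 𝒰 (nhds (-m)) := by
        simpa only [inner_neg_right] using hm.neg
      have := aux_avg hlc hxc hlam_pos hΛ hxt (cesaro (-w) (-L) h1) hU h2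
      linarith
  obtain ⟨xinf, hxinf, hconv⟩ := cluster (Ultrafilter.of atTop) (Ultrafilter.of_le _)
  refine ⟨xinf, hxinf, fun u => ?_⟩
  rw [tendsto_iff_ultrafilter]
  intro 𝒰 hU
  obtain ⟨z, hz, hzc⟩ := cluster 𝒰 hU
  have hzx : z = xinf := by
    obtain ⟨l1, hl1⟩ := (stepZ z hz).1
    obtain ⟨l2, hl2'⟩ := (stepZ xinf hxinf).1
    have h1 := ((hl2'.sub hl1).add_const (‖z‖ ^ 2 / 2 - ‖xinf‖ ^ 2 / 2))
    have h2 : Tendsto (fun t => (⟪x t, z - xinf⟫ : ℝ)) atTop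
        (nhds (l2 - l1 + (‖z‖ ^ 2 / 2 - ‖xinf‖ ^ 2 / 2))) := by
      refine h1.congr fun t => ?_
      rw [norm_sub_sq_real, norm_sub_sq_real, inner_sub_right]
      ring
    have h3 := cesaro_eq _ _ h2 𝒰 hU _ (hzc _)
    have h4 := cesaro_eq _ _ h2 _ (Ultrafilter.of_le _) _ (hconv _)
    have h5 : (⟪z - xinf, z - xinf⟫ : ℝ) = 0 := by
      rw [inner_sub_left, h3, h4, sub_self]
    exact sub_eq_zero.1 (inner_self_eq_zero.1 h5)
  rw [← hzx]
  exact hzc u
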